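/- Let B ∈ ℝ^{L×K} and C ∈ ℝ^{L×N} with ℓ-th rows bℓᵀ = (bℓ1, b̃ℓᵀ) ∈ ℝ × ℝ^{K−1} and cℓᵀ = (cℓ1, c̃ℓᵀ) ∈ ℝ × ℝ^{N−1}. Let h♮ = e₁ ∈ ℝ^K, m♮ = e₁ ∈ ℝ^N, and yℓ = bℓ1·cℓ1. Suppose that for every (δm̃, δh̃) ∈ ℝ^{N−1} × ℝ^{K−1} there exists ℓ ∈ {1,…,L} with bℓ1 ≠ 0, cℓ1 ≠ 0, and ⟨c̃ℓ/cℓ1, δm̃⟩ + ⟨b̃ℓ/bℓ1, δh̃⟩ ≤ 0. Then (h♮, m♮) = (e₁, e₁) is the unique minimizer of ‖h‖₂² + ‖m‖₂² over the set {(h,m) ∈ ℝ^K × ℝ^N : yℓ·((bℓᵀh)(cℓᵀm♮) + (bℓᵀh♮)(cℓᵀm)) ≥ 2yℓ² for all ℓ = 1,…,L}. -/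

import Mathlib

/-- The first standard basis vector `e₁` of `ℝ^{n+1}` as a Euclidean space element. -/
noncomputable def e1 (n : ℕ) : EuclideanSpace ℝ (Fin (n + 1)) :=
  EuclideanSpace.single 0 1

/-- Feasibility for the linearized program at `h♮ = e₁`, `m♮ = e₁`. -/
def LinFeas {L K N : ℕ} (B : Fin L → Fin (K + 1) → ℝ) (C : Fin L → Fin (N + 1) → ℝ)
    (y : Fin L → ℝ) (h : EuclideanSpace ℝ (Fin (K + 1)))
    (m : EuclideanSpace ℝ (Fin (N + 1))) : Prop :=
  ∀ ℓ, y ℓ * ((∑ i, B ℓ i * h i) * (∑ j, C ℓ j * e1 N j) +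
      (∑ i, B ℓ i * e1 K i) * (∑ j, C ℓ j * m j)) ≥ 2 * y ℓ ^ 2

theorem sum_mul_e1 {n : ℕ} (a : Fin (n + 1) → ℝ) : ∑ i, a i * e1 n i = a 0 := by
  simp [e1]

theorem norm_e1_sq (n : ℕ) : ‖e1 n‖ ^ 2 = 1 := by
  simp [e1]

theorem norm_sub_e1_sq {n : ℕ} (x : EuclideanSpace ℝ (Fin (n + 1))) :
    ‖x - e1 n‖ ^ 2 = ‖x‖ ^ 2 - 2 * x 0 + 1 := by
  have hx : inner ℝ x (e1 n) = x 0 := by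
    simp [e1, EuclideanSpace.inner_single_right]
  rw [norm_sub_sq_real, hx, norm_e1_sq]

/-- A constraint with nonzero data, divided by `(b c)²`. -/
theorem two_le_of_linearized_constraint {K N : ℕ} {b : Fin (K + 1) → ℝ} {c : Fin (N + 1) → ℝ}
    (hb : b 0 ≠ 0) (hc : c 0 ≠ 0) {h : Fin (K + 1) → ℝ} {m : Fin (N + 1) → ℝ}
    (hf : 2 * (b 0 * c 0) ^ 2 ≤
      (b 0 * c 0) * ((∑ i, b i * h i) * c 0 + b 0 * ∑ j, c j * m j)) :
    2 ≤ h 0 + m 0 + ((∑ j : Fin N, c j.succ / c 0 * m j.succ) +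
      ∑ i : Fin K, b i.succ / b 0 * h i.succ) := by
  have factor {n : ℕ} {a : Fin (n + 1) → ℝ} (ha : a 0 ≠ 0) (x : Fin (n + 1) → ℝ) :
      ∑ i, a i * x i = a 0 * (x 0 + ∑ i : Fin n, a i.succ / a 0 * x i.succ) := by
    rw [Fin.sum_univ_succ, mul_add, Finset.mul_sum]
    congr 1
    refine Finset.sum_congr rfl fun i _ => ?_
    field_simp
  rw [factor hb h, factor hc m] at hf
  have hpos : 0 < (b 0 * c 0) ^ 2 := by positivity
  refine le_of_mul_le_mul_left ?_ hpos
  linarith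

/-- Here the ambient dimensions are `K+1` and `N+1`, so the tails `b̃ℓ`, `c̃ℓ` live in
`ℝ^K` and `ℝ^N` respectively.  If for every `(δm̃, δh̃)` some `ℓ` has `bℓ1 ≠ 0`,
`cℓ1 ≠ 0` and `⟨c̃ℓ/cℓ1, δm̃⟩ + ⟨b̃ℓ/bℓ1, δh̃⟩ ≤ 0`, then `(e₁, e₁)` is the unique
minimizer of the linearized program. -/
theorem stmt7 {L K N : ℕ} (B : Fin L → Fin (K + 1) → ℝ) (C : Fin L → Fin (N + 1) → ℝ)
    (y : Fin L → ℝ) (hy : ∀ ℓ, y ℓ = B ℓ 0 * C ℓ 0)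
    (hcover : ∀ (δm : Fin N → ℝ) (δh : Fin K → ℝ), ∃ ℓ, B ℓ 0 ≠ 0 ∧ C ℓ 0 ≠ 0 ∧
      (∑ j, C ℓ j.succ / C ℓ 0 * δm j) + (∑ i, B ℓ i.succ / B ℓ 0 * δh i) ≤ 0) :
    LinFeas B C y (e1 K) (e1 N) ∧
      ∀ h m, LinFeas B C y h m → (h, m) ≠ (e1 K, e1 N) →
        ‖e1 K‖ ^ 2 + ‖e1 N‖ ^ 2 < ‖h‖ ^ 2 + ‖m‖ ^ 2 := by
  constructor
  · intro ℓ
    simp only [sum_mul_e1, hy]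
    exact le_of_eq (by ring)
  · intro h m hf hne
    obtain ⟨ℓ, hb, hc, hle⟩ := hcover (fun j => m j.succ) (fun i => h i.succ)
    have hfℓ := hf ℓ
    simp only [sum_mul_e1, hy] at hfℓ
    have h2 := two_le_of_linearized_constraint hb hc hfℓ
    have hh := norm_sub_e1_sq h
    have hm := norm_sub_e1_sq m
    have hpos : 0 < ‖h - e1 K‖ ^ 2 + ‖m - e1 N‖ ^ 2 := by
      by_cases hK : h = e1 K
      · have hN : m ≠ e1 N := fun hN => hne (by rw [hK, hN])
        have := norm_pos_iff.mpr (sub_ne_zero.mpr hN)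
        positivity
      · have := norm_pos_iff.mpr (sub_ne_zero.mpr hK)
        positivity
    rw [norm_e1_sq, norm_e1_sq]
    linarith
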